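/- Let σ, r_θ, r_φ > 0. There is no continuous function G : S² × S² → ℝ such that G(P(θ₁,φ₁), P(θ₂,φ₂)) = σ · exp(−|φ₁ − φ₂| / r_φ) · exp(−|θ₁ − θ₂| / r_θ) for all θ₁, θ₂ ∈ [0, π] and all φ₁, φ₂ ∈ (−π/2, π/2). In other words, the separated longitude–latitude covariance of equation (8) admits no continuous extension to the whole sphere: the limiting value at a pole depends on the longitude along which the pole is approached. -/

import Mathlib

open Real

/-- The spherical parametrization P(θ,φ) = (cos φ cos θ, cos φ sin θ, sin φ). -/
noncomputable def sphParam (θ φ : ℝ) : EuclideanSpace ℝ (Fin 3) :=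
  (WithLp.equiv 2 (Fin 3 → ℝ)).symm ![cos φ * cos θ, cos φ * sin θ, sin φ]

theorem sphParam_mem_sphere (θ φ : ℝ) :
    sphParam θ φ ∈ Metric.sphere (0 : EuclideanSpace ℝ (Fin 3)) 1 := by
  rw [mem_sphere_zero_iff_norm, EuclideanSpace.norm_eq]
  have h : ∑ i : Fin 3, ‖sphParam θ φ i‖ ^ 2 = 1 := by
    simp only [Fin.sum_univ_three, Real.norm_eq_abs, sq_abs, sphParam,
      WithLp.equiv_symm_apply, PiLp.toLp_apply, Matrix.cons_val_zero, Matrix.cons_val_one,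
      Matrix.head_cons, Matrix.cons_val_two, Matrix.tail_cons]
    nlinarith [sin_sq_add_cos_sq φ, sin_sq_add_cos_sq θ]
  rw [h, Real.sqrt_one]

/-- The point of the unit sphere with longitude θ and latitude φ. -/
noncomputable def sphPoint (θ φ : ℝ) : Metric.sphere (0 : EuclideanSpace ℝ (Fin 3)) 1 :=
  ⟨sphParam θ φ, sphParam_mem_sphere θ φ⟩

theorem continuous_sphPoint (θ : ℝ) : Continuous (sphPoint θ) := by
  refine Continuous.subtype_mk ((PiLp.continuous_toLp 2 _).comp (continuous_pi fun i => ?_)) _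
  fin_cases i <;> simp <;> fun_prop

/-- The north pole has every longitude. -/
theorem sphPoint_pi_div_two (θ : ℝ) : sphPoint θ (π / 2) = sphPoint 0 (π / 2) := by
  simp [sphPoint, sphParam]

/-- A function continuous on the real line and constant on `(-π/2, π/2)` has the same
value at `π/2`. -/
theorem Continuous.eq_at_pi_div_two_of_const {f : ℝ → ℝ} (hf : Continuous f) {c : ℝ}
    (h : ∀ φ ∈ Set.Ioo (-(π / 2)) (π / 2), f φ = c) : f (π / 2) = c := by
  have hcl : Set.EqOn f (fun _ => c) (closure (Set.Ioo (-(π / 2)) (π / 2))) :=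
    Set.EqOn.closure h hf continuous_const
  have hlt : -(π / 2) < π / 2 := by linarith [pi_pos]
  rw [closure_Ioo hlt.ne] at hcl
  exact hcl (Set.right_mem_Icc.2 hlt.le)

/-- The separated longitude–latitude covariance (equation (8) of the paper) admits
no continuous extension to the whole sphere. -/
theorem separated_covariance_not_continuous (σ rθ rφ : ℝ)
    (hσ : 0 < σ) (hrθ : 0 < rθ) (hrφ : 0 < rφ) :
    ¬ ∃ G : (Metric.sphere (0 : EuclideanSpace ℝ (Fin 3)) 1) ×
            (Metric.sphere (0 : EuclideanSpace ℝ (Fin 3)) 1) → ℝ,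
        Continuous G ∧
        ∀ θ₁ ∈ Set.Icc (0 : ℝ) π, ∀ θ₂ ∈ Set.Icc (0 : ℝ) π,
          ∀ φ₁ ∈ Set.Ioo (-(π / 2)) (π / 2), ∀ φ₂ ∈ Set.Ioo (-(π / 2)) (π / 2),
            G (sphPoint θ₁ φ₁, sphPoint θ₂ φ₂) =
              σ * exp (-|φ₁ - φ₂| / rφ) * exp (-|θ₁ - θ₂| / rθ) := by
  rintro ⟨G, hG, h⟩
  have pole : ∀ θ ∈ Set.Icc (0 : ℝ) π,
      G (sphPoint 0 (π / 2), sphPoint 0 (π / 2)) = σ * exp (-θ / rθ) := by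
    intro θ hθ
    have key := Continuous.eq_at_pi_div_two_of_const
      (f := fun φ => G (sphPoint θ φ, sphPoint 0 φ)) (c := σ * exp (-θ / rθ))
      (hG.comp ((continuous_sphPoint θ).prodMk (continuous_sphPoint 0)))
      (fun φ hφ => by
        simp [h θ hθ 0 (Set.left_mem_Icc.2 pi_pos.le) φ hφ φ hφ, abs_of_nonneg hθ.1])
    simpa only [sphPoint_pi_div_two θ] using key
  have heq := (pole 0 (Set.left_mem_Icc.2 pi_pos.le)).symm.trans
    (pole π (Set.right_mem_Icc.2 pi_pos.le))
  have hexp := exp_injective (mul_left_cancel₀ hσ.ne' heq)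
  have hpos : 0 < π / rθ := div_pos pi_pos hrθ
  rw [neg_div, neg_div, zero_div] at hexp
  linarith
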